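/- Gang FJP schedulers with a Parallelism Monotonic priority assignment are predictable on identical multiprocessor platforms: for every ordered job set J with execution times e_i ∈ [e_i⁻, e_i⁺] and every i ≥ 1 such that J⁺⁽ⁱ⁾ is schedulable, S(J⁻⁽ⁱ⁾) ≤ S(J⁽ⁱ⁾) ≤ S(J⁺⁽ⁱ⁾) and F(J⁻⁽ⁱ⁾) ≤ F(J⁽ⁱ⁾) ≤ F(J⁺⁽ⁱ⁾). -/

import Mathlib

/-- A parallel rigid job `J = (r, v, e, d)`: release time `r`, required number of
processors `v`, execution requirement `e`, absolute deadline `d`. -/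
structure Job where
  r : ℕ
  v : ℕ
  e : ℕ
  d : ℕ

/-- Number of currently free processors in a one-instant processor assignment
(`0` denotes an idle processor). -/
def freeCount {m : ℕ} (σt : Fin m → ℕ) : ℕ :=
  (Finset.univ.filter fun k => σt k = 0).card

/-- Assign the job with identifier `id` to the first `v` free processors. -/
def assignJob {m : ℕ} (σt : Fin m → ℕ) (id v : ℕ) : Fin m → ℕ := fun k =>
  if σt k = 0 ∧ (Finset.univ.filter fun k' => σt k' = 0 ∧ k' < k).card < v then id
  else σt k

/-- One scheduling pass of the (limited or not) Gang scheduler over the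
priority-ordered list of active jobs, given as pairs `(id, v)`: the
highest-priority active job is placed on the first `v` available processors if at
least `v` are available; otherwise it is skipped and the same rule is applied to
the remaining jobs (non-limited variant, `limited = false`), or the pass stops at
this first job that cannot be scheduled (limited variant, `limited = true`). -/
def gangPass (m : ℕ) (limited : Bool) : List (ℕ × ℕ) → (Fin m → ℕ) → (Fin m → ℕ)
  | [], σt => σt
  | (id, v) :: rest, σt =>
    if v ≤ freeCount σt then gangPass m limited rest (assignJob σt id v)
    else if limited then σt
    else gangPass m limited rest σt

/-- The priority-ordered list `(i+1, vᵢ)` of jobs among the `p` highest-priority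
jobs of `J` that are active at time `t` (released, remaining work not exhausted). -/
def activeJobs (J : ℕ → Job) (p t : ℕ) (rem : ℕ → ℕ) : List (ℕ × ℕ) :=
  ((List.range p).filter fun i => decide ((J i).r ≤ t ∧ rem i ≠ 0)).map fun i =>
    (i + 1, (J i).v)

/-- Remaining execution requirement of job `i` at the start of slot `t` in the
Gang FJP schedule of the `p` highest-priority jobs `J⁽ᵖ⁾ = {J₀, …, J_{p-1}}` on
`m` identical processors (`J₀ > J₁ > ⋯` is the decreasing priority order). -/
def remWork (m : ℕ) (J : ℕ → Job) (limited : Bool) (p : ℕ) : ℕ → ℕ → ℕ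
  | 0, i => (J i).e
  | t + 1, i =>
    let σt := gangPass m limited (activeJobs J p t (remWork m J limited p t)) fun _ => 0
    if ∃ k : Fin m, σt k = i + 1 then remWork m J limited p t i - 1
    else remWork m J limited p t i

/-- The schedule `σ(t)`: `schedAt m J limited p t k = i + 1` iff job `Jᵢ` occupies
processor `π_k` at time `t`, and `= 0` iff `π_k` is idle. -/
def schedAt (m : ℕ) (J : ℕ → Job) (limited : Bool) (p t : ℕ) : Fin m → ℕ :=
  gangPass m limited (activeJobs J p t (remWork m J limited p t)) fun _ => 0

/-- `S(J⁽ᵖ⁾)` for `p = i+1`: the time at which job `Jᵢ` begins its execution in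
the schedule of the `p` highest-priority jobs. -/
noncomputable def startTime (m : ℕ) (J : ℕ → Job) (limited : Bool) (p i : ℕ) : ℕ :=
  sInf {t | ∃ k : Fin m, schedAt m J limited p t k = i + 1}

/-- `F(J⁽ᵖ⁾)` for `p = i+1`: the time at which job `Jᵢ` completes its execution in
the schedule of the `p` highest-priority jobs. -/
noncomputable def finishTime (m : ℕ) (J : ℕ → Job) (limited : Bool) (p i : ℕ) : ℕ :=
  sInf {t | remWork m J limited p t i = 0}

/-- The set of the `p` highest-priority jobs of `J` is schedulable if each of these
jobs completes by its deadline. -/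
def Schedulable (m : ℕ) (J : ℕ → Job) (limited : Bool) (p : ℕ) : Prop :=
  ∀ i < p, remWork m J limited p ((J i).d) i = 0

/-- `#A(J⁽ᵖ⁾,t)`: the number of available processors at time `t` in the schedule
of the `p` highest-priority jobs of `J`. -/
def availCount (m : ℕ) (J : ℕ → Job) (limited : Bool) (p t : ℕ) : ℕ :=
  (Finset.univ.filter fun k : Fin m => schedAt m J limited p t k = 0).card


theorem card_filter_rank_lt {α : Type*} [LinearOrder α] (s : Finset α) {v : ℕ}
    (hv : v ≤ s.card) :
    (s.filter fun k => (s.filter fun k' => k' < k).card < v).card = v := by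
  classical
  set rank : α → ℕ := fun k => (s.filter fun k' => k' < k).card
  have hlt : ∀ a ∈ s, ∀ b, a < b → rank a < rank b := by
    intro a ha b hab
    refine Finset.card_lt_card (Finset.ssubset_iff_subset_ne.2 ⟨?_, ?_⟩)
    · intro x hx
      simp only [Finset.mem_filter] at hx ⊢
      exact ⟨hx.1, hx.2.trans hab⟩
    · intro h
      have : a ∈ s.filter fun k' => k' < a := by rw [h]; simp [ha, hab]
      simp at this
  have hinj : Set.InjOn rank s := by
    intro a ha b hb hab
    rcases lt_trichotomy a b with h | h | h
    · exact absurd hab (hlt a ha b h).ne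
    · exact h
    · exact absurd hab (hlt b hb a h).ne'
  have himg : s.image rank = Finset.range s.card := by
    refine Finset.eq_of_subset_of_card_le ?_ ?_
    · intro x hx
      obtain ⟨a, ha, rfl⟩ := Finset.mem_image.1 hx
      refine Finset.mem_range.2 (Finset.card_lt_card ?_)
      exact Finset.filter_ssubset.2 ⟨a, ha, lt_irrefl a⟩
    · rw [Finset.card_image_of_injOn hinj, Finset.card_range]
  have hfil : (s.filter fun k => rank k < v).image rank = Finset.range v := by
    have h := Finset.filter_image (s := s) (f := rank) (p := fun n => n < v)
    rw [← h, himg]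
    ext x
    simp only [Finset.mem_filter, Finset.mem_range]
    omega
  have hcard := congrArg Finset.card hfil
  rwa [Finset.card_image_of_injOn (hinj.mono (Finset.coe_subset.2 (Finset.filter_subset _ _))),
    Finset.card_range] at hcard

theorem card_assigned {m : ℕ} (σt : Fin m → ℕ) {v : ℕ} (hv : v ≤ freeCount σt) :
    (Finset.univ.filter fun k => σt k = 0 ∧
      (Finset.univ.filter fun k' => σt k' = 0 ∧ k' < k).card < v).card = v := by
  have h := card_filter_rank_lt (Finset.univ.filter fun k => σt k = 0) hv
  simpa only [Finset.filter_filter] using h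

theorem freeCount_assignJob {m : ℕ} (σt : Fin m → ℕ) {id v : ℕ} (hid : id ≠ 0)
    (hv : v ≤ freeCount σt) : freeCount (assignJob σt id v) = freeCount σt - v := by
  have h := Finset.card_filter_add_card_filter_not
    (s := Finset.univ.filter fun k => σt k = 0)
    (fun k => (Finset.univ.filter fun k' => σt k' = 0 ∧ k' < k).card < v)
  simp only [Finset.filter_filter] at h
  rw [card_assigned σt hv] at h
  have heq : freeCount (assignJob σt id v) = (Finset.univ.filter fun k => σt k = 0 ∧
      ¬ (Finset.univ.filter fun k' => σt k' = 0 ∧ k' < k).card < v).card := by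
    unfold freeCount assignJob
    congr 1
    ext k
    simp only [Finset.mem_filter, Finset.mem_univ, true_and]
    split_ifs <;> tauto
  change _ = (Finset.univ.filter fun k => σt k = 0).card - v
  omega

theorem exists_assignJob_eq_iff {m : ℕ} (σt : Fin m → ℕ) {id v : ℕ} (hv1 : 1 ≤ v)
    (hv : v ≤ freeCount σt) {n : ℕ} (hn : n ≠ 0) :
    (∃ k, assignJob σt id v k = n) ↔ n = id ∨ ∃ k, σt k = n := by
  constructor
  · rintro ⟨k, hk⟩
    unfold assignJob at hk
    split_ifs at hk
    · exact Or.inl hk.symm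
    · exact Or.inr ⟨k, hk⟩
  · rintro (rfl | ⟨k, hk⟩)
    · have hpos := card_assigned σt hv
      obtain ⟨k, hk⟩ := Finset.card_pos.1 (hv1.trans_eq hpos.symm)
      exact ⟨k, if_pos (Finset.mem_filter.1 hk).2⟩
    · refine ⟨k, ?_⟩
      unfold assignJob
      rw [if_neg (by rw [hk]; tauto), hk]

theorem gangPass_append (m : ℕ) (l₁ l₂ : List (ℕ × ℕ)) (σt : Fin m → ℕ) :
    gangPass m false (l₁ ++ l₂) σt = gangPass m false l₂ (gangPass m false l₁ σt) := by
  induction l₁ generalizing σt with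
  | nil => rfl
  | cons a l ih =>
    obtain ⟨id, v⟩ := a
    simp only [List.cons_append, gangPass, Bool.false_eq_true, if_false]
    split_ifs <;> exact ih _

/-- The processor assignment at time `t` after the `q` highest-priority jobs have been
considered, when the remaining work is given by `rem`. -/
def partialPass (m : ℕ) (J : ℕ → Job) (t : ℕ) (rem : ℕ → ℕ) (q : ℕ) : Fin m → ℕ :=
  gangPass m false (activeJobs J q t rem) fun _ => 0

theorem partialPass_succ (m : ℕ) (J : ℕ → Job) (t : ℕ) (rem : ℕ → ℕ) (q : ℕ) :
    partialPass m J t rem (q + 1) =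
      if ((J q).r ≤ t ∧ rem q ≠ 0) ∧ (J q).v ≤ freeCount (partialPass m J t rem q) then
        assignJob (partialPass m J t rem q) (q + 1) (J q).v
      else partialPass m J t rem q := by
  have happ : activeJobs J (q + 1) t rem = activeJobs J q t rem ++
      if (J q).r ≤ t ∧ rem q ≠ 0 then [(q + 1, (J q).v)] else [] := by
    by_cases h : (J q).r ≤ t ∧ rem q ≠ 0
    · simp [activeJobs, List.range_succ, h]
    · rw [if_neg h]
      simp only [activeJobs, List.range_succ, List.filter_append, List.map_append]
      simp [h]
  rw [partialPass, happ, gangPass_append]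
  by_cases h : (J q).r ≤ t ∧ rem q ≠ 0
  · rw [if_pos h]
    simp [gangPass, h, partialPass]
  · rw [if_neg h, if_neg fun h' => h h'.1]
    rfl

theorem freeCount_partialPass_succ (m : ℕ) (J : ℕ → Job) (t : ℕ) (rem : ℕ → ℕ) (q : ℕ) :
    freeCount (partialPass m J t rem (q + 1)) =
      if ((J q).r ≤ t ∧ rem q ≠ 0) ∧ (J q).v ≤ freeCount (partialPass m J t rem q) then
        freeCount (partialPass m J t rem q) - (J q).v
      else freeCount (partialPass m J t rem q) := by
  rw [partialPass_succ]
  split_ifs with h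
  · exact freeCount_assignJob _ (Nat.succ_ne_zero q) h.2
  · rfl

theorem exists_partialPass_eq_iff (m : ℕ) (J : ℕ → Job) (hv1 : ∀ i, 1 ≤ (J i).v) (t : ℕ)
    (rem : ℕ → ℕ) (q i : ℕ) :
    (∃ k, partialPass m J t rem q k = i + 1) ↔
      i < q ∧ ((J i).r ≤ t ∧ rem i ≠ 0) ∧ (J i).v ≤ freeCount (partialPass m J t rem i) := by
  induction q with
  | zero => simp [partialPass, activeJobs, gangPass]
  | succ q ih =>
    rw [partialPass_succ]
    split_ifs with h
    · rw [exists_assignJob_eq_iff _ (hv1 q) h.2 (Nat.succ_ne_zero i), ih]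
      constructor
      · rintro (h' | h')
        · obtain rfl : i = q := by omega
          exact ⟨i.lt_succ_self, h⟩
        · exact ⟨h'.1.trans q.lt_succ_self, h'.2⟩
      · rintro ⟨hi, h'⟩
        rcases Nat.lt_succ_iff_lt_or_eq.1 hi with hi | rfl
        · exact Or.inr ⟨hi, h'⟩
        · exact Or.inl rfl
    · rw [ih]
      constructor
      · exact fun h' => ⟨h'.1.trans q.lt_succ_self, h'.2⟩
      · rintro ⟨hi, h'⟩
        rcases Nat.lt_succ_iff_lt_or_eq.1 hi with hi | rfl
        · exact ⟨hi, h'⟩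
        · exact absurd h' h

theorem freeCount_partialPass_anti (m : ℕ) (A B : ℕ → Job) (hr : ∀ i, (A i).r = (B i).r)
    (hv : ∀ i, (A i).v = (B i).v) (hmono : Monotone fun i => (B i).v) (t : ℕ)
    {remA remB : ℕ → ℕ} (hrem : ∀ i, remA i ≤ remB i) (q : ℕ)
    (hq : (B q).v ≤ freeCount (partialPass m B t remB q)) :
    freeCount (partialPass m B t remB q) ≤ freeCount (partialPass m A t remA q) := by
  induction q with
  | zero => simp [partialPass, activeJobs, gangPass]
  | succ q ih =>
    have hstep := hmono (Nat.le_succ q)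
    have hremq := hrem q
    simp only [Nat.succ_eq_add_one] at hstep
    rw [freeCount_partialPass_succ] at hq ⊢
    rw [freeCount_partialPass_succ, hr, hv]
    split_ifs at hq ⊢ <;> omega

/-- Job `i` runs at time `t` in the schedule of the `p` highest-priority jobs. -/
def RunsAt (m : ℕ) (J : ℕ → Job) (p t i : ℕ) : Prop :=
  ∃ k : Fin m, schedAt m J false p t k = i + 1

theorem runsAt_iff (m : ℕ) (J : ℕ → Job) (hv1 : ∀ i, 1 ≤ (J i).v) (p t i : ℕ) :
    RunsAt m J p t i ↔ i < p ∧ ((J i).r ≤ t ∧ remWork m J false p t i ≠ 0) ∧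
      (J i).v ≤ freeCount (partialPass m J t (remWork m J false p t) i) :=
  exists_partialPass_eq_iff m J hv1 t _ p i

open Classical in
theorem remWork_succ (m : ℕ) (J : ℕ → Job) (p t i : ℕ) :
    remWork m J false p (t + 1) i =
      if RunsAt m J p t i then remWork m J false p t i - 1 else remWork m J false p t i := by
  rw [remWork]
  unfold RunsAt schedAt
  congr

theorem remWork_eq_of_not_runsAt (m : ℕ) (J : ℕ → Job) (p t i : ℕ)
    (h : ∀ s < t, ¬ RunsAt m J p s i) : remWork m J false p t i = (J i).e := by
  induction t with
  | zero => rfl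
  | succ t ih =>
    rw [remWork_succ, if_neg (h t t.lt_succ_self), ih fun s hs => h s (hs.trans t.lt_succ_self)]

theorem RunsAt.of_remWork_le {m : ℕ} {A B : ℕ → Job} (hr : ∀ i, (A i).r = (B i).r)
    (hv : ∀ i, (A i).v = (B i).v) (hv1 : ∀ i, 1 ≤ (B i).v)
    (hmono : Monotone fun i => (B i).v) {p t i : ℕ}
    (hrem : ∀ j, remWork m A false p t j ≤ remWork m B false p t j)
    (hB : RunsAt m B p t i) (hA : remWork m A false p t i ≠ 0) : RunsAt m A p t i := by
  rw [runsAt_iff m B hv1] at hB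
  rw [runsAt_iff m A (fun j => (hv1 j).trans_eq (hv j).symm)]
  refine ⟨hB.1, ⟨(hr i).trans_le hB.2.1.1, hA⟩, ?_⟩
  exact (hv i).trans_le
    (hB.2.2.trans (freeCount_partialPass_anti m A B hr hv hmono t hrem i hB.2.2))

theorem remWork_le_remWork {m : ℕ} {A B : ℕ → Job} (hr : ∀ i, (A i).r = (B i).r)
    (hv : ∀ i, (A i).v = (B i).v) (he : ∀ i, (A i).e ≤ (B i).e) (hv1 : ∀ i, 1 ≤ (B i).v)
    (hmono : Monotone fun i => (B i).v) (p t i : ℕ) :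
    remWork m A false p t i ≤ remWork m B false p t i := by
  induction t generalizing i with
  | zero => exact he i
  | succ t ih =>
    have hi := ih i
    have hrun := RunsAt.of_remWork_le hr hv hv1 hmono (i := i) ih
    rw [remWork_succ, remWork_succ]
    split_ifs with h₁ h₂ h₂
    · omega
    · omega
    · by_cases h0 : remWork m A false p t i = 0
      · omega
      · exact absurd (hrun h₂ h0) h₁
    · exact hi

theorem finishTime_le_finishTime {m : ℕ} {A B : ℕ → Job} (hr : ∀ i, (A i).r = (B i).r)
    (hv : ∀ i, (A i).v = (B i).v) (he : ∀ i, (A i).e ≤ (B i).e) (hv1 : ∀ i, 1 ≤ (B i).v)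
    (hmono : Monotone fun i => (B i).v) {p i d : ℕ} (hB : remWork m B false p d i = 0) :
    finishTime m A false p i ≤ finishTime m B false p i := by
  have hmem : finishTime m B false p i ∈ {t | remWork m B false p t i = 0} :=
    Nat.sInf_mem ⟨d, hB⟩
  exact Nat.sInf_le
    (Nat.le_zero.1 ((remWork_le_remWork hr hv he hv1 hmono p _ i).trans_eq hmem))

theorem startTime_le_startTime {m : ℕ} {A B : ℕ → Job} (hr : ∀ i, (A i).r = (B i).r)
    (hv : ∀ i, (A i).v = (B i).v) (he : ∀ i, (A i).e ≤ (B i).e) (hv1 : ∀ i, 1 ≤ (B i).v)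
    (hmono : Monotone fun i => (B i).v) {p i d : ℕ} (hB : remWork m B false p d i = 0) :
    startTime m A false p i ≤ startTime m B false p i := by
  have hrem := remWork_le_remWork (m := m) hr hv he hv1 hmono p
  by_contra! hlt
  have hA : ∀ s < startTime m A false p i, ¬ RunsAt m A p s i := fun s hs =>
    Nat.notMem_of_lt_sInf hs
  have hne : (A i).e ≠ 0 := by
    intro h0
    have hAt : ∃ t, RunsAt m A p t i :=
      Nat.nonempty_of_pos_sInf (Nat.zero_lt_of_lt hlt)
    obtain ⟨t, ht⟩ := hAt
    have hanti : ∀ t, remWork m A false p t i = 0 := by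
      intro t
      induction t with
      | zero => exact h0
      | succ t ih => rw [remWork_succ, ih]; split_ifs <;> rfl
    rw [runsAt_iff m A (fun j => (hv1 j).trans_eq (hv j).symm)] at ht
    exact ht.2.1.2 (hanti t)
  have hBt : ∃ t, RunsAt m B p t i := by
    by_contra! hno
    have h := remWork_eq_of_not_runsAt m B p d i fun s _ => hno s
    have := he i
    omega
  have hBrun : RunsAt m B p (startTime m B false p i) i := Nat.sInf_mem hBt
  refine hA _ hlt (RunsAt.of_remWork_le hr hv hv1 hmono (hrem _) hBrun ?_)
  rwa [remWork_eq_of_not_runsAt m A p _ i fun s hs => hA s (hs.trans hlt)]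

/-- **Theorem 1: Gang FJP schedulers with a Parallelism Monotonic priority
assignment are predictable on identical platforms.**
Let `Jminus`, `J`, `Jplus` be the ordered job sets (0-indexed, decreasing
priorities, identical release times, processor requirements and deadlines) with
execution times `eᵢ⁻ ≤ eᵢ ≤ eᵢ⁺` respectively, with a Parallelism Monotonic
priority assignment (`i ≤ j → vᵢ ≤ v_j`). For every `i` such that
`J⁺⁽ⁱ⁺¹⁾ = {J₀⁺, …, Jᵢ⁺}` is schedulable by Gang FJP on `m` identical processors:
`S(J⁻⁽ⁱ⁺¹⁾) ≤ S(J⁽ⁱ⁺¹⁾) ≤ S(J⁺⁽ⁱ⁺¹⁾)` and `F(J⁻⁽ⁱ⁺¹⁾) ≤ F(J⁽ⁱ⁺¹⁾) ≤ F(J⁺⁽ⁱ⁺¹⁾)`. -/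
theorem gang_fjp_parallelism_monotonic_predictable
    (m : ℕ) (Jminus J Jplus : ℕ → Job)
    (hr : ∀ i, (Jminus i).r = (J i).r ∧ (Jplus i).r = (J i).r)
    (hv : ∀ i, (Jminus i).v = (J i).v ∧ (Jplus i).v = (J i).v)
    (hd : ∀ i, (Jminus i).d = (J i).d ∧ (Jplus i).d = (J i).d)
    (he : ∀ i, (Jminus i).e ≤ (J i).e ∧ (J i).e ≤ (Jplus i).e)
    (hv1 : ∀ i, 1 ≤ (J i).v)
    (hmono : ∀ i j, i ≤ j → (J i).v ≤ (J j).v) :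
    ∀ i, Schedulable m Jplus false (i + 1) →
      (startTime m Jminus false (i + 1) i ≤ startTime m J false (i + 1) i ∧
       startTime m J false (i + 1) i ≤ startTime m Jplus false (i + 1) i) ∧
      (finishTime m Jminus false (i + 1) i ≤ finishTime m J false (i + 1) i ∧
       finishTime m J false (i + 1) i ≤ finishTime m Jplus false (i + 1) i) := by
  intro i hsched
  have hPlus : remWork m Jplus false (i + 1) (Jplus i).d i = 0 := hsched i i.lt_succ_self
  have hvP : ∀ j, (J j).v = (Jplus j).v := fun j => (hv j).2.symm
  have hrP : ∀ j, (J j).r = (Jplus j).r := fun j => (hr j).2.symm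
  have heP : ∀ j, (J j).e ≤ (Jplus j).e := fun j => (he j).2
  have hv1P : ∀ j, 1 ≤ (Jplus j).v := fun j => (hv1 j).trans_eq (hvP j)
  have hmonoJ : Monotone fun j => (J j).v := fun a b => hmono a b
  have hmonoP : Monotone fun j => (Jplus j).v := by simpa only [hvP] using hmonoJ
  have hJ : remWork m J false (i + 1) (Jplus i).d i = 0 :=
    Nat.le_zero.1 ((remWork_le_remWork hrP hvP heP hv1P hmonoP _ _ i).trans_eq hPlus)
  have hrM : ∀ j, (Jminus j).r = (J j).r := fun j => (hr j).1
  have hvM : ∀ j, (Jminus j).v = (J j).v := fun j => (hv j).1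
  have heM : ∀ j, (Jminus j).e ≤ (J j).e := fun j => (he j).1
  exact ⟨⟨startTime_le_startTime hrM hvM heM hv1 hmonoJ hJ,
      startTime_le_startTime hrP hvP heP hv1P hmonoP hPlus⟩,
    finishTime_le_finishTime hrM hvM heM hv1 hmonoJ hJ,
    finishTime_le_finishTime hrP hvP heP hv1P hmonoP hPlus⟩
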